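/- Richness ratio of larger RoI-feasible classes against safe strategies: let m, m' ∈ ℕ with m ≤ m'. (Upper bound) For every bid history H₋ = (β₋^1,…,β₋^T) and every valuation vector v, sup_{b' ∈ 𝒬_{≤m'}(H₋)} ∑_{t=1}^{T} V(b';β₋^t) ≤ (2m'/m) · max_{b ∈ 𝒫*_{≤m}} ∑_{t=1}^{T} V(b;β₋^t). (Tightness) For every δ ∈ (0, 1/2] there exist T, K, M, a valuation vector v and a bid history H₋ such that max_{b ∈ 𝒫*_{≤m}} ∑_{t=1}^{T} V(b;β₋^t) > 0 and sup_{b' ∈ 𝒬_{≤m'}(H₋)} ∑_{t=1}^{T} V(b';β₋^t) ≥ (2m'/m − δ) · max_{b ∈ 𝒫*_{≤m}} ∑_{t=1}^{T} V(b;β₋^t). -/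

import Mathlib

open Finset

namespace Auction

/-- A competing-bid profile for an auction of `K` identical units, represented by the
function sending `j ∈ {1,…,K}` to the `j`-th smallest element of the multiset of the
`K` largest competing bids. -/
structure Profile (K : ℕ) where
  c : ℕ → ℝ
  mono : ∀ i j : ℕ, 1 ≤ i → i ≤ j → j ≤ K → c i ≤ c j
  nonneg : ∀ j : ℕ, 1 ≤ j → j ≤ K → 0 ≤ c j

/-- A bid vector: `n` units are demanded and `bid j` is the bid for the `j`-th unit
(for `1 ≤ j ≤ n`). -/
structure BidVec where
  n : ℕ
  bid : ℕ → ℝ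

/-- A bid vector is valid if its bids are non-increasing and positive. -/
def BidVec.Valid (b : BidVec) : Prop :=
  (∀ i j : ℕ, 1 ≤ i → i ≤ j → j ≤ b.n → b.bid j ≤ b.bid i) ∧
  ∀ j : ℕ, 1 ≤ j → j ≤ b.n → 0 < b.bid j

open Classical in
/-- The number of units the bidder wins (ties broken in the bidder's favor): the
largest `r ≤ min n K` such that the bidder's `j`-th bid is at least the `j`-th
threshold `β.c j` for every `j ≤ r`. -/
noncomputable def alloc (K : ℕ) (b : BidVec) (β : Profile K) : ℕ :=
  ((Finset.Icc 1 (min b.n K)).filter fun r => ∀ j ∈ Finset.Icc 1 r, β.c j ≤ b.bid j).sup id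

/-- The clearing price: the `K`-th highest among all submitted bids (taken to be `0`
when the bidder wins no unit). -/
noncomputable def price (K : ℕ) (b : BidVec) (β : Profile K) : ℝ :=
  if alloc K b β = 0 then 0
  else if alloc K b β < K then min (b.bid (alloc K b β)) (β.c (alloc K b β + 1))
  else b.bid K

/-- The value obtained by the bidder. -/
noncomputable def value (v : ℕ → ℝ) (K : ℕ) (b : BidVec) (β : Profile K) : ℝ :=
  ∑ j ∈ Finset.Icc 1 (alloc K b β), v j

/-- The bidder's total payment. -/
noncomputable def payment (K : ℕ) (b : BidVec) (β : Profile K) : ℝ :=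
  price K b β * (alloc K b β : ℝ)

/-- The RoI constraint (with target RoI `γ = 0`) against a single competing-bid profile. -/
def Feasible (v : ℕ → ℝ) (K : ℕ) (b : BidVec) (β : Profile K) : Prop :=
  payment K b β ≤ value v K b β

/-- A bid vector is safe if it satisfies the RoI constraint against every profile. -/
def Safe (v : ℕ → ℝ) (K : ℕ) (b : BidVec) : Prop :=
  ∀ β : Profile K, Feasible v K b β

/-- A valuation vector: nonnegative and non-increasing on `{1,…,M}`. -/
def ValidValuation (M : ℕ) (v : ℕ → ℝ) : Prop :=
  (∀ j : ℕ, 1 ≤ j → j ≤ M → 0 ≤ v j) ∧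
  ∀ i j : ℕ, 1 ≤ i → i ≤ j → j ≤ M → v j ≤ v i

/-- The average cumulative valuation `w_j = (v_1 + ⋯ + v_j) / j`. -/
noncomputable def w (v : ℕ → ℝ) (j : ℕ) : ℝ :=
  (∑ ℓ ∈ Finset.Icc 1 j, v ℓ) / (j : ℝ)

/-- An `m`-uniform bidding strategy: bid-quantity pairs `(b j, q j)` for `1 ≤ j ≤ m`. -/
structure Uniform where
  m : ℕ
  b : ℕ → ℝ
  q : ℕ → ℕ

/-- Cumulative quantities `Q j = q 1 + ⋯ + q j`. -/
def Uniform.Q (s : Uniform) (j : ℕ) : ℕ := ∑ ℓ ∈ Finset.Icc 1 j, s.q ℓ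

/-- `s` is a genuine `m`-uniform strategy for maximum demand `M`:
`b 1 > b 2 > ⋯ > b m > 0`, positive quantities, and `Q m ≤ M`. -/
def Uniform.IsUniform (M : ℕ) (s : Uniform) : Prop :=
  1 ≤ s.m ∧
  (∀ j : ℕ, 1 ≤ j → j ≤ s.m → 0 < s.q j) ∧
  0 < s.b s.m ∧
  (∀ j : ℕ, 1 ≤ j → j < s.m → s.b (j + 1) < s.b j) ∧
  s.Q s.m ≤ M

/-- The bid vector associated to a uniform strategy: the bid on the `j`-th unit is
`b ℓ`, where `ℓ` is least with `j ≤ Q ℓ`. -/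
noncomputable def Uniform.toBidVec (s : Uniform) : BidVec :=
  ⟨s.Q s.m, fun j => s.b (sInf {ℓ : ℕ | j ≤ s.Q ℓ})⟩

/-- The 1-uniform strategy bidding `b` on `q` units. -/
def single (b : ℝ) (q : ℕ) : Uniform := ⟨1, fun _ => b, fun _ => q⟩

/-- Membership in the class `𝒫*_{≤ m}` of safe undominated strategies with at most `m`
bid-quantity pairs: strategies determined by a tuple `0 < Q 1 < ⋯ < Q k ≤ M` (`k ≤ m`)
via `b ℓ = w (Q ℓ)` and `q ℓ = Q ℓ - Q (ℓ-1)`. -/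
def InSafeClass (M : ℕ) (v : ℕ → ℝ) (m : ℕ) (s : Uniform) : Prop :=
  1 ≤ s.m ∧ s.m ≤ m ∧ (∀ j : ℕ, 1 ≤ j → j ≤ s.m → 0 < s.q j) ∧ s.Q s.m ≤ M ∧
  ∀ ℓ : ℕ, 1 ≤ ℓ → ℓ ≤ s.m → s.b ℓ = w v (s.Q ℓ)

/-- Membership in the class `𝒬_{≤ m}(H)` of strategies with at most `m` bid-quantity
pairs that are RoI-feasible for the bid history `H` over rounds `1,…,T`. -/
def InFeasClass (M : ℕ) (v : ℕ → ℝ) (K T : ℕ) (H : ℕ → Profile K) (m : ℕ) (s : Uniform) : Prop :=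
  s.IsUniform M ∧ s.m ≤ m ∧ ∀ t ∈ Finset.Icc 1 T, Feasible v K s.toBidVec (H t)

/-- Total value obtained by strategy `s` over the bid history `H` on rounds `1,…,T`. -/
noncomputable def totalValue (v : ℕ → ℝ) (K T : ℕ) (H : ℕ → Profile K) (s : Uniform) : ℝ :=
  ∑ t ∈ Finset.Icc 1 T, value v K s.toBidVec (H t)

/-- The optimal total value over the class `𝒫*_{≤ m}`. -/
noncomputable def bestSafe (M : ℕ) (v : ℕ → ℝ) (K T : ℕ) (H : ℕ → Profile K) (m : ℕ) : ℝ :=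
  sSup {x : ℝ | ∃ s : Uniform, InSafeClass M v m s ∧ x = totalValue v K T H s}

/-- The optimal total value over the class `𝒬_{≤ m}(H)`. -/
noncomputable def bestFeas (M : ℕ) (v : ℕ → ℝ) (K T : ℕ) (H : ℕ → Profile K) (m : ℕ) : ℝ :=
  sSup {x : ℝ | ∃ s : Uniform, InFeasClass M v K T H m s ∧ x = totalValue v K T H s}

section Allocation

variable {K : ℕ} {b : BidVec} {β : Profile K}

lemma le_alloc {r : ℕ} (hr : 1 ≤ r) (hn : r ≤ b.n) (hK : r ≤ K)
    (h : ∀ j, 1 ≤ j → j ≤ r → β.c j ≤ b.bid j) : r ≤ alloc K b β := by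
  classical
  unfold alloc
  refine Finset.le_sup (f := id) (b := r) ?_
  simp only [Finset.mem_filter, Finset.mem_Icc]
  exact ⟨⟨hr, le_min hn hK⟩, fun j hj => h j hj.1 hj.2⟩

lemma alloc_spec : alloc K b β ≤ b.n ∧ alloc K b β ≤ K ∧
    ∀ j, 1 ≤ j → j ≤ alloc K b β → β.c j ≤ b.bid j := by
  classical
  rcases Nat.eq_zero_or_pos (alloc K b β) with h | h
  · rw [h]
    exact ⟨Nat.zero_le _, Nat.zero_le _, fun j h1 h2 => by omega⟩
  · unfold alloc at h ⊢
    set F := (Finset.Icc 1 (min b.n K)).filter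
      fun r => ∀ j ∈ Finset.Icc 1 r, β.c j ≤ b.bid j with hF
    have hne : F.Nonempty := by
      by_contra hne
      rw [Finset.not_nonempty_iff_eq_empty] at hne
      simp [hne] at h
    obtain ⟨r, hr, hre⟩ := Finset.exists_mem_eq_sup F hne id
    rw [hre]
    simp only [hF, Finset.mem_filter, Finset.mem_Icc, le_min_iff] at hr
    exact ⟨hr.1.2.1, hr.1.2.2, fun j h1 h2 => hr.2 j ⟨h1, h2⟩⟩

lemma bid_lt_of_alloc_lt (hn : alloc K b β < b.n) (hK : alloc K b β < K) :
    b.bid (alloc K b β + 1) < β.c (alloc K b β + 1) := by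
  by_contra! hcon
  have := le_alloc (β := β) (b := b) (r := alloc K b β + 1) (by omega) hn hK fun j h1 h2 => by
    rcases Nat.lt_or_ge j (alloc K b β + 1) with h | h
    · exact alloc_spec.2.2 j h1 (by omega)
    · obtain rfl : j = alloc K b β + 1 := by omega
      exact hcon
  omega

lemma feasible_of_price_le {v : ℕ → ℝ} (h : price K b β ≤ w v (alloc K b β)) :
    Feasible v K b β := by
  unfold Feasible payment value
  rcases Nat.eq_zero_or_pos (alloc K b β) with h0 | h0
  · simp [h0]
  · have : (0 : ℝ) < alloc K b β := by exact_mod_cast h0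
    rwa [← le_div_iff₀ this]

lemma price_le_of_feasible {v : ℕ → ℝ} (h0 : 0 < alloc K b β) (h : Feasible v K b β) :
    price K b β ≤ w v (alloc K b β) := by
  have : (0 : ℝ) < alloc K b β := by exact_mod_cast h0
  exact (le_div_iff₀ this).2 h

end Allocation

section Valuation

variable {M : ℕ} {v : ℕ → ℝ}

lemma w_antitone (hv : ValidValuation M v) {i j : ℕ} (hi : 1 ≤ i) (hij : i ≤ j) (hj : j ≤ M) :
    w v j ≤ w v i := by
  induction j, hij using Nat.le_induction with
  | base => exact le_rfl
  | succ j hij ih =>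
    refine le_trans ?_ (ih (by omega))
    have hj0 : (0 : ℝ) < j := by exact_mod_cast (by omega : 0 < j)
    have hsum : (j : ℝ) * v (j + 1) ≤ ∑ ℓ ∈ Finset.Icc 1 j, v ℓ := by
      have := Finset.card_nsmul_le_sum (Finset.Icc 1 j) v (v (j + 1)) fun x hx => by
        rw [Finset.mem_Icc] at hx
        exact hv.2 x (j + 1) hx.1 (by omega) hj
      simpa using this
    unfold w
    rw [Finset.sum_Icc_succ_top (by omega), div_le_div_iff₀ (by positivity) hj0]
    push_cast
    nlinarith

lemma sum_Icc_mono (hv : ValidValuation M v) {i j : ℕ} (hij : i ≤ j) (hj : j ≤ M) :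
    ∑ ℓ ∈ Finset.Icc 1 i, v ℓ ≤ ∑ ℓ ∈ Finset.Icc 1 j, v ℓ := by
  refine Finset.sum_le_sum_of_subset_of_nonneg (Finset.Icc_subset_Icc_right hij) fun x hx _ => ?_
  rw [Finset.mem_Icc] at hx
  exact hv.1 x hx.1 (hx.2.trans hj)

lemma sum_Icc_nonneg (hv : ValidValuation M v) {j : ℕ} (hj : j ≤ M) :
    0 ≤ ∑ ℓ ∈ Finset.Icc 1 j, v ℓ := by
  simpa using sum_Icc_mono hv (Nat.zero_le j) hj

end Valuation

namespace Uniform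

variable (s : Uniform)

@[simp] lemma Q_zero : s.Q 0 = 0 := by simp [Q]

lemma Q_succ (j : ℕ) : s.Q (j + 1) = s.Q j + s.q (j + 1) := by
  unfold Q
  rw [Finset.sum_Icc_succ_top (by omega)]

lemma Q_mono : Monotone s.Q := monotone_nat_of_le_succ fun j => by
  rw [Q_succ]
  omega

lemma one_le_Q (hq : ∀ j : ℕ, 1 ≤ j → j ≤ s.m → 0 < s.q j) {ℓ : ℕ} (h1 : 1 ≤ ℓ)
    (h2 : ℓ ≤ s.m) : 1 ≤ s.Q ℓ := by
  obtain ⟨k, rfl⟩ : ∃ k, ℓ = k + 1 := ⟨ℓ - 1, by omega⟩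
  have := hq (k + 1) h1 h2
  rw [Q_succ]
  omega

lemma bid_eq {ℓ j : ℕ} (hlt : s.Q (ℓ - 1) < j) (hle : j ≤ s.Q ℓ) :
    s.toBidVec.bid j = s.b ℓ := by
  have hmem : ℓ ∈ {ℓ : ℕ | j ≤ s.Q ℓ} := hle
  have hinf : sInf {ℓ : ℕ | j ≤ s.Q ℓ} = ℓ := by
    refine le_antisymm (Nat.sInf_le hmem) ?_
    by_contra! hcon
    have h1 : j ≤ s.Q (sInf {ℓ : ℕ | j ≤ s.Q ℓ}) := Nat.sInf_mem ⟨ℓ, hmem⟩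
    have h2 := s.Q_mono (show sInf {ℓ : ℕ | j ≤ s.Q ℓ} ≤ ℓ - 1 by omega)
    omega
  simp [toBidVec, hinf]

lemma exists_bucket {j : ℕ} (h1 : 1 ≤ j) (h2 : j ≤ s.Q s.m) :
    ∃ ℓ, 1 ≤ ℓ ∧ ℓ ≤ s.m ∧ s.Q (ℓ - 1) < j ∧ j ≤ s.Q ℓ ∧ s.toBidVec.bid j = s.b ℓ := by
  have hex : ∃ ℓ, j ≤ s.Q ℓ := ⟨s.m, h2⟩
  classical
  have hspec := Nat.find_spec hex
  have hpos : Nat.find hex ≠ 0 := fun h => by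
    rw [h, Q_zero] at hspec
    omega
  have hlt : s.Q (Nat.find hex - 1) < j := by
    have := Nat.find_min hex (show Nat.find hex - 1 < Nat.find hex by omega)
    omega
  exact ⟨Nat.find hex, by omega, Nat.find_min' hex h2, hlt, hspec, s.bid_eq hlt hspec⟩

end Uniform

lemma alloc_le_demand {M K : ℕ} {s : Uniform} (hQ : s.Q s.m ≤ M) (β : Profile K) :
    alloc K s.toBidVec β ≤ M :=
  (alloc_spec (b := s.toBidVec)).1.trans hQ

lemma InSafeClass.le_alloc {M K m : ℕ} {v : ℕ → ℝ} {s : Uniform} (hs : InSafeClass M v m s)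
    (hv : ValidValuation M v) (hMK : M ≤ K) {β : Profile K} {ℓ r : ℕ}
    (hℓm : ℓ ≤ s.m) (hr : 1 ≤ r) (hrQ : r ≤ s.Q ℓ) (hc : β.c r ≤ w v (s.Q ℓ)) :
    r ≤ alloc K s.toBidVec β := by
  obtain ⟨-, -, hq, hQM, hb⟩ := hs
  have hQm := s.Q_mono hℓm
  refine Auction.le_alloc hr (hrQ.trans hQm) (by omega) fun j h1 h2 => ?_
  obtain ⟨ℓ', hℓ1, hℓ2, hlt, hle, hbid⟩ := s.exists_bucket h1 (by omega)
  have hℓℓ : ℓ' ≤ ℓ := by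
    by_contra! hcon
    have := s.Q_mono (show ℓ ≤ ℓ' - 1 by omega)
    omega
  rw [hbid, hb ℓ' hℓ1 hℓ2]
  calc β.c j ≤ β.c r := β.mono j r h1 h2 (by omega)
    _ ≤ w v (s.Q ℓ) := hc
    _ ≤ w v (s.Q ℓ') := w_antitone hv (s.one_le_Q hq hℓ1 hℓ2) (s.Q_mono hℓℓ) (by omega)

section TotalValue

variable {M K T m : ℕ} {v : ℕ → ℝ} {H : ℕ → Profile K} {s : Uniform}

lemma totalValue_nonneg (hv : ValidValuation M v) (hQ : s.Q s.m ≤ M) :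
    0 ≤ totalValue v K T H s :=
  Finset.sum_nonneg fun t _ => sum_Icc_nonneg hv (alloc_le_demand hQ (H t))

lemma totalValue_le (hv : ValidValuation M v) (hQ : s.Q s.m ≤ M) :
    totalValue v K T H s ≤ ∑ _t ∈ Finset.Icc 1 T, ∑ ℓ ∈ Finset.Icc 1 M, v ℓ :=
  Finset.sum_le_sum fun t _ => sum_Icc_mono hv (alloc_le_demand hQ (H t)) le_rfl

lemma totalValue_le_bestSafe (hv : ValidValuation M v) (hs : InSafeClass M v m s) :
    totalValue v K T H s ≤ bestSafe M v K T H m := by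
  refine le_csSup ⟨∑ _t ∈ Finset.Icc 1 T, ∑ ℓ ∈ Finset.Icc 1 M, v ℓ, ?_⟩ ⟨s, hs, rfl⟩
  rintro x ⟨s', hs', rfl⟩
  exact totalValue_le hv hs'.2.2.2.1

lemma totalValue_le_bestFeas (hv : ValidValuation M v) (hs : InFeasClass M v K T H m s) :
    totalValue v K T H s ≤ bestFeas M v K T H m := by
  refine le_csSup ⟨∑ _t ∈ Finset.Icc 1 T, ∑ ℓ ∈ Finset.Icc 1 M, v ℓ, ?_⟩ ⟨s, hs, rfl⟩
  rintro x ⟨s', hs', rfl⟩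
  exact totalValue_le hv hs'.1.2.2.2.2

lemma bestSafe_nonneg (hv : ValidValuation M v) : 0 ≤ bestSafe M v K T H m := by
  refine Real.sSup_nonneg ?_
  rintro x ⟨s, hs, rfl⟩
  exact totalValue_nonneg hv hs.2.2.2.1

end TotalValue

section SafeOfFinset

/-- The safe undominated strategy whose cumulative quantities are the elements of `S`. -/
noncomputable def safeOf (v : ℕ → ℝ) (S : Finset ℕ) : Uniform where
  m := #S
  b j := w v (Nat.nth (· ∈ insert 0 S) j)
  q j := Nat.nth (· ∈ insert 0 S) j - Nat.nth (· ∈ insert 0 S) (j - 1)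

variable {M : ℕ} {v : ℕ → ℝ} {S : Finset ℕ}

lemma exists_finite_card_insert_zero (hS : S ⊆ Finset.Icc 1 M) :
    ∃ hfin : (Set.ofPred (· ∈ insert 0 S)).Finite, #hfin.toFinset = #S + 1 := by
  have h0 : 0 ∉ S := fun h => by simpa using hS h
  refine ⟨(insert 0 S).finite_toSet, ?_⟩
  rw [← Finset.card_insert_of_notMem h0]
  congr 1
  ext x
  rw [Set.Finite.mem_toFinset]
  rfl

lemma nth_insert_zero_strictMonoOn (hS : S ⊆ Finset.Icc 1 M) :
    StrictMonoOn (Nat.nth (· ∈ insert 0 S)) (Set.Iic #S) := by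
  obtain ⟨hfin, hcard⟩ := exists_finite_card_insert_zero hS
  intro i hi j hj hij
  rw [Set.mem_Iic] at hi hj
  exact Nat.nth_strictMonoOn hfin (Set.mem_Iio.2 (by omega)) (Set.mem_Iio.2 (by omega)) hij

lemma safeOf_Q (hS : S ⊆ Finset.Icc 1 M) {j : ℕ} (hj : j ≤ #S) :
    (safeOf v S).Q j = Nat.nth (· ∈ insert 0 S) j := by
  induction j with
  | zero => rw [Uniform.Q_zero, Nat.nth_zero_of_zero (Finset.mem_insert_self 0 S)]
  | succ j ih =>
    have := nth_insert_zero_strictMonoOn hS (Set.mem_Iic.2 (by omega : j ≤ #S))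
      (Set.mem_Iic.2 hj) (Nat.lt_succ_self j)
    rw [Uniform.Q_succ, ih (by omega)]
    simp only [safeOf, Nat.add_sub_cancel]
    omega

lemma exists_safeOf_Q_eq (hS : S ⊆ Finset.Icc 1 M) {x : ℕ} (hx : x ∈ S) :
    ∃ ℓ ≤ (safeOf v S).m, (safeOf v S).Q ℓ = x := by
  obtain ⟨hfin, hcard⟩ := exists_finite_card_insert_zero hS
  obtain ⟨ℓ, hℓ, he⟩ := Nat.exists_lt_card_finite_nth_eq (p := (· ∈ insert 0 S)) hfin
    (Finset.mem_insert_of_mem hx)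
  have hle : ℓ ≤ #S := by omega
  exact ⟨ℓ, hle, by rw [safeOf_Q hS hle, he]⟩

lemma safeOf_inSafeClass {m : ℕ} (hS : S ⊆ Finset.Icc 1 M) (hne : S.Nonempty) (hm : #S ≤ m) :
    InSafeClass M v m (safeOf v S) := by
  obtain ⟨hfin, hcard⟩ := exists_finite_card_insert_zero hS
  refine ⟨Finset.card_pos.2 hne, hm, fun j h1 h2 => ?_, ?_, fun ℓ _ h2 => ?_⟩
  · have h2' : j ≤ #S := h2
    have := nth_insert_zero_strictMonoOn hS (Set.mem_Iic.2 (by omega : j - 1 ≤ #S))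
      (Set.mem_Iic.2 h2') (by omega)
    simp only [safeOf]
    omega
  · have hmem := Nat.nth_mem_of_lt_card (p := (· ∈ insert 0 S)) hfin (n := #S) (by omega)
    rw [safeOf_Q hS (by simp [safeOf])]
    change Nat.nth (· ∈ insert 0 S) #S ≤ M
    rcases Finset.mem_insert.1 hmem with h | h
    · omega
    · exact (Finset.mem_Icc.1 (hS h)).2
  · rw [safeOf_Q hS h2]
    rfl

end SafeOfFinset

section Selection

variable {ι : Type*} [DecidableEq ι]

lemma exists_subset_card_eq_mul_sum_le (f : ι → ℝ) {m : ℕ} (hm : 1 ≤ m) (n : ℕ) (hn : m ≤ n)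
    (C : Finset ι) (hC : #C = n) :
    ∃ S ⊆ C, #S = m ∧ (m : ℝ) * ∑ i ∈ C, f i ≤ n * ∑ i ∈ S, f i := by
  induction n, hn using Nat.le_induction generalizing C with
  | base => exact ⟨C, subset_rfl, hC, le_rfl⟩
  | succ n hn ih =>
    obtain ⟨x, hx, hmin⟩ := C.exists_min_image f (Finset.card_pos.1 (by omega))
    obtain ⟨S, hSC, hS, hsum⟩ := ih (C.erase x) (by rw [Finset.card_erase_of_mem hx]; omega)
    refine ⟨S, hSC.trans (Finset.erase_subset _ _), hS, ?_⟩
    have hle : ((n : ℝ) + 1) * f x ≤ ∑ i ∈ C, f i := by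
      have := Finset.card_nsmul_le_sum C f (f x) hmin
      rw [hC] at this
      simpa using this
    have herase := Finset.add_sum_erase C f hx
    have hn0 : (0 : ℝ) < n := by exact_mod_cast (by omega : 0 < n)
    have hm0 : (0 : ℝ) < m := by exact_mod_cast hm
    refine le_of_mul_le_mul_left ?_ hn0
    push_cast
    set A := ∑ i ∈ C, f i
    set B := ∑ i ∈ C.erase x, f i
    have h1 : (n : ℝ) * A ≤ (n + 1) * B := by nlinarith
    have h2 := mul_le_mul_of_nonneg_left h1 hm0.le
    have h3 := mul_le_mul_of_nonneg_left hsum (by positivity : (0 : ℝ) ≤ n + 1)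
    nlinarith

lemma exists_subset_card_le_mul_sum_le {f : ι → ℝ} {C : Finset ι} (hf : ∀ i ∈ C, 0 ≤ f i)
    {m N : ℕ} (hm : 1 ≤ m) (hmN : m ≤ N) (hC : #C ≤ N) (hne : C.Nonempty) :
    ∃ S ⊆ C, S.Nonempty ∧ #S ≤ m ∧ (m : ℝ) * ∑ i ∈ C, f i ≤ N * ∑ i ∈ S, f i := by
  rcases le_total #C m with h | h
  · exact ⟨C, subset_rfl, hne, h,
      mul_le_mul_of_nonneg_right (by exact_mod_cast hmN) (Finset.sum_nonneg hf)⟩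
  · obtain ⟨S, hSC, hS, hsum⟩ := exists_subset_card_eq_mul_sum_le f hm #C h C rfl
    refine ⟨S, hSC, Finset.card_pos.1 (by omega), hS.le, hsum.trans ?_⟩
    exact mul_le_mul_of_nonneg_right (by exact_mod_cast hC)
      (Finset.sum_nonneg fun i hi => hf i (hSC hi))

end Selection

section UpperBound

variable {M K T m : ℕ} {v : ℕ → ℝ} {H : ℕ → Profile K}

/-- If the won quantities `r t` can be grouped into at most `N` classes such that within each
class the average cumulative valuation at a larger quantity covers the threshold at a smaller
one, then the best safe strategy with `m` pairs recovers a fraction `m / N` of the value. -/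
lemma mul_sum_le_mul_bestSafe {ι : Type*} [DecidableEq ι] (hv : ValidValuation M v) (hMK : M ≤ K)
    (hm : 1 ≤ m) {N : ℕ} (hmN : m ≤ N) {P : Finset ℕ} (hP : P ⊆ Finset.Icc 1 T) (r : ℕ → ℕ)
    (hr1 : ∀ t ∈ P, 1 ≤ r t) (hrM : ∀ t ∈ P, r t ≤ M) (a : ℕ → ι) (hN : #(P.image a) ≤ N)
    (hcover : ∀ t ∈ P, ∀ t' ∈ P, a t = a t' → r t ≤ r t' → (H t).c (r t) ≤ w v (r t')) :
    (m : ℝ) * ∑ t ∈ P, ∑ ℓ ∈ Finset.Icc 1 (r t), v ℓ ≤ N * bestSafe M v K T H m := by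
  rcases P.eq_empty_or_nonempty with rfl | hPne
  · simpa using mul_nonneg (Nat.cast_nonneg N) (bestSafe_nonneg hv)
  have hV : ∀ t ∈ P, 0 ≤ ∑ ℓ ∈ Finset.Icc 1 (r t), v ℓ := fun t ht =>
    sum_Icc_nonneg hv (hrM t ht)
  obtain ⟨S, hSC, hSne, hSm, hsum⟩ := exists_subset_card_le_mul_sum_le
    (f := fun i => ∑ t ∈ P with a t = i, ∑ ℓ ∈ Finset.Icc 1 (r t), v ℓ) (C := P.image a)
    (fun i _ => Finset.sum_nonneg fun t ht => hV t (Finset.mem_filter.1 ht).1)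
    hm hmN hN (hPne.image a)
  rw [Finset.sum_fiberwise_of_maps_to fun t ht => Finset.mem_image_of_mem a ht] at hsum
  have hmax : ∀ i ∈ P.image a, ∃ t ∈ P, a t = i ∧ ∀ t' ∈ P, a t' = i → r t' ≤ r t := by
    intro i hi
    obtain ⟨t₀, ht₀, hat₀⟩ := Finset.mem_image.1 hi
    obtain ⟨t, ht, htmax⟩ := (P.filter (a · = i)).exists_max_image r
      ⟨t₀, Finset.mem_filter.2 ⟨ht₀, hat₀⟩⟩
    rw [Finset.mem_filter] at ht
    exact ⟨t, ht.1, ht.2, fun t' h1 h2 => htmax t' (Finset.mem_filter.2 ⟨h1, h2⟩)⟩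
  choose! τ hτP hτa hτmax using hmax
  set S' := S.image fun i => r (τ i)
  have hS'M : S' ⊆ Finset.Icc 1 M := by
    intro x hx
    obtain ⟨i, hi, rfl⟩ := Finset.mem_image.1 hx
    exact Finset.mem_Icc.2 ⟨hr1 _ (hτP i (hSC hi)), hrM _ (hτP i (hSC hi))⟩
  have hsafe : InSafeClass M v m (safeOf v S') :=
    safeOf_inSafeClass hS'M (hSne.image _) (Finset.card_image_le.trans hSm)
  refine hsum.trans (mul_le_mul_of_nonneg_left ?_ (Nat.cast_nonneg N))
  refine le_trans ?_ (totalValue_le_bestSafe hv hsafe)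
  have hQ := hsafe.2.2.2.1
  calc ∑ i ∈ S, ∑ t ∈ P with a t = i, ∑ ℓ ∈ Finset.Icc 1 (r t), v ℓ
      ≤ ∑ i ∈ S, ∑ t ∈ P with a t = i, value v K (safeOf v S').toBidVec (H t) := by
        refine Finset.sum_le_sum fun i hi => Finset.sum_le_sum fun t ht => ?_
        obtain ⟨htP, hta⟩ := Finset.mem_filter.1 ht
        obtain ⟨ℓ, hℓ, hQℓ⟩ := exists_safeOf_Q_eq (v := v) hS'M
          (Finset.mem_image_of_mem (fun i => r (τ i)) hi)
        have hle := hτmax i (hSC hi) t htP hta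
        refine sum_Icc_mono hv (hsafe.le_alloc hv hMK hℓ (hr1 t htP) ?_ ?_)
          (alloc_le_demand hQ (H t))
        · rw [hQℓ]
          exact hle
        · rw [hQℓ]
          exact hcover t htP _ (hτP i (hSC hi)) (hta.trans (hτa i (hSC hi)).symm) hle
    _ = ∑ t ∈ P with a t ∈ S, value v K (safeOf v S').toBidVec (H t) := by
        rw [← Finset.sum_fiberwise_of_maps_to (s := P.filter (a · ∈ S)) (t := S) (g := a)
          fun t ht => (Finset.mem_filter.1 ht).2]
        refine Finset.sum_congr rfl fun i hi => Finset.sum_congr ?_ fun _ _ => rfl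
        ext t
        simp only [Finset.mem_filter]
        constructor
        · rintro ⟨h1, rfl⟩
          exact ⟨⟨h1, hi⟩, rfl⟩
        · rintro ⟨⟨h1, _⟩, h2⟩
          exact ⟨h1, h2⟩
    _ ≤ totalValue v K T H (safeOf v S') :=
        Finset.sum_le_sum_of_subset_of_nonneg ((Finset.filter_subset _ _).trans hP)
          fun t _ _ => sum_Icc_nonneg hv (alloc_le_demand hQ (H t))

/-- In a feasible round, the threshold of the last unit won is covered by the average cumulative
valuation if a bid level is exhausted, and the level's bid is covered otherwise. -/
lemma threshold_le_of_feasible {s : Uniform} (hQM : s.Q s.m ≤ M) (hMK : M ≤ K) {β : Profile K}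
    (hfeas : Feasible v K s.toBidVec β) {ℓ r : ℕ} (hr : r = alloc K s.toBidVec β) (hr1 : 1 ≤ r)
    (hℓm : ℓ ≤ s.m) (hlt : s.Q (ℓ - 1) < r) (hle : r ≤ s.Q ℓ) :
    β.c r ≤ s.b ℓ ∧ β.c r ≤ w v r ∧ (r < s.Q ℓ → s.b ℓ ≤ w v r) := by
  have hQm := s.Q_mono hℓm
  have hprice := price_le_of_feasible (by omega) hfeas
  have hbid := s.bid_eq hlt hle
  have hcb : β.c r ≤ s.b ℓ := by
    rw [← hbid]
    exact alloc_spec.2.2 r hr1 hr.le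
  unfold price at hprice
  rw [← hr, if_neg (by omega), hbid] at hprice
  refine ⟨hcb, ?_, fun hrQ => ?_⟩
  · refine le_trans ?_ hprice
    split_ifs with hrK
    · exact le_min hcb (β.mono r (r + 1) hr1 (by omega) (by omega))
    · obtain rfl : r = K := by omega
      rwa [hbid]
  · rw [if_pos (by omega)] at hprice
    have hnext := bid_lt_of_alloc_lt (K := K) (b := s.toBidVec) (β := β)
      (by change _ < s.Q s.m; omega) (by omega)
    rw [← hr, s.bid_eq (ℓ := ℓ) (by omega) (by omega)] at hnext
    rwa [min_eq_left hnext.le] at hprice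

lemma mul_totalValue_le_mul_bestSafe {m' : ℕ} {s : Uniform} (hv : ValidValuation M v)
    (hMK : M ≤ K) (hm : 1 ≤ m) (hmm' : m ≤ m') (hs : InFeasClass M v K T H m' s) :
    (m : ℝ) * totalValue v K T H s ≤ 2 * m' * bestSafe M v K T H m := by
  obtain ⟨⟨-, -, -, -, hQM⟩, hsm, hfeas⟩ := hs
  set r : ℕ → ℕ := fun t => alloc K s.toBidVec (H t)
  set P := (Finset.Icc 1 T).filter (1 ≤ r ·) with hP
  have hrM : ∀ t, r t ≤ M := fun t => alloc_le_demand hQM (H t)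
  have hrQ : ∀ t, r t ≤ s.Q s.m := fun t => (alloc_spec (b := s.toBidVec)).1
  have hbucket : ∀ t ∈ P, ∃ ℓ, 1 ≤ ℓ ∧ ℓ ≤ s.m ∧ s.Q (ℓ - 1) < r t ∧ r t ≤ s.Q ℓ := by
    intro t ht
    obtain ⟨ℓ, h1, h2, h3, h4, -⟩ := s.exists_bucket (Finset.mem_filter.1 ht).2 (hrQ t)
    exact ⟨ℓ, h1, h2, h3, h4⟩
  choose! L hL1 hLm hLlt hLle using hbucket
  have htotal : totalValue v K T H s = ∑ t ∈ P, ∑ ℓ ∈ Finset.Icc 1 (r t), v ℓ := by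
    symm
    refine Finset.sum_subset (Finset.filter_subset _ _) fun t ht htP => ?_
    have : r t = 0 := by
      simp only [hP, Finset.mem_filter, not_and] at htP
      have := htP ht
      omega
    simp [this]
  have hkey := mul_sum_le_mul_bestSafe (T := T) (H := H) (N := 2 * m') (P := P) hv hMK hm
    (by omega) (Finset.filter_subset _ _) r (fun t ht => (Finset.mem_filter.1 ht).2)
    (fun t _ => hrM t) (fun t => (L t, decide (r t = s.Q (L t)))) ?_ ?_
  · rw [htotal]
    simpa using hkey
  · calc _ ≤ #(Finset.Icc 1 s.m ×ˢ (Finset.univ : Finset Bool)) := by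
          refine Finset.card_le_card fun x hx => ?_
          obtain ⟨t, ht, rfl⟩ := Finset.mem_image.1 hx
          simp [hL1 t ht, hLm t ht, em]
      _ ≤ 2 * m' := by
          rw [Finset.card_product]
          simp
          omega
  · intro t ht t' ht' haa hrr
    have hspec : ∀ t ∈ P, (H t).c (r t) ≤ s.b (L t) ∧ (H t).c (r t) ≤ w v (r t) ∧
        (r t < s.Q (L t) → s.b (L t) ≤ w v (r t)) := fun t ht =>
      threshold_le_of_feasible hQM hMK (hfeas t (Finset.mem_filter.1 ht).1) rfl
        (Finset.mem_filter.1 ht).2 (hLm t ht) (hLlt t ht) (hLle t ht)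
    rw [Prod.mk.injEq, decide_eq_decide] at haa
    obtain ⟨hLL, hiff⟩ := haa
    by_cases hfull : r t = s.Q (L t)
    · have : r t' = r t := by rw [hiff.1 hfull, hfull, hLL]
      rw [this]
      exact (hspec t ht).2.1
    · have hlt' : r t' < s.Q (L t') := lt_of_le_of_ne (hLle t' ht') (mt hiff.2 hfull)
      refine (hspec t ht).1.trans ?_
      rw [hLL]
      exact (hspec t' ht').2.2 hlt'

lemma bestFeas_le {m' : ℕ} (hv : ValidValuation M v) (hMK : M ≤ K) (hm : 1 ≤ m)
    (hmm' : m ≤ m') :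
    bestFeas M v K T H m' ≤ (2 * (m' : ℝ) / (m : ℝ)) * bestSafe M v K T H m := by
  have hm0 : (0 : ℝ) < m := by exact_mod_cast hm
  refine Real.sSup_le ?_ (mul_nonneg (by positivity) (bestSafe_nonneg hv))
  rintro x ⟨s, hs, rfl⟩
  rw [div_mul_eq_mul_div, le_div_iff₀ hm0, mul_comm]
  exact mul_totalValue_le_mul_bestSafe hv hMK hm hmm' hs

end UpperBound

section Tightness

/-- The valuation `(2, 1, 1, …)`. -/
noncomputable def tightVal (j : ℕ) : ℝ := if j = 1 then 2 else 1

lemma tightVal_valid (M : ℕ) : ValidValuation M tightVal := by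
  refine ⟨fun j _ _ => ?_, fun i j hi hij _ => ?_⟩
  · unfold tightVal
    split_ifs <;> norm_num
  · unfold tightVal
    split_ifs with h1 h2 h2
    · rfl
    · omega
    · norm_num
    · rfl

lemma sum_tightVal {y : ℕ} (hy : 1 ≤ y) : ∑ ℓ ∈ Finset.Icc 1 y, tightVal ℓ = y + 1 := by
  induction y, hy using Nat.le_induction with
  | base => norm_num [tightVal]
  | succ y hy ih =>
    rw [Finset.sum_Icc_succ_top (by omega), ih, tightVal, if_neg (by omega)]
    push_cast
    ring

lemma sum_tightVal_le (y : ℕ) : ∑ ℓ ∈ Finset.Icc 1 y, tightVal ℓ ≤ y + 1 := by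
  rcases Nat.eq_zero_or_pos y with rfl | hy
  · simp
  · exact (sum_tightVal hy).le

lemma w_tightVal {y : ℕ} (hy : 1 ≤ y) : w tightVal y = 1 + (y : ℝ)⁻¹ := by
  have : (y : ℝ) ≠ 0 := by
    have : y ≠ 0 := by omega
    exact_mod_cast this
  rw [w, sum_tightVal hy]
  field_simp

lemma one_add_inv_le {a b : ℕ} (ha : 1 ≤ a) (hab : a ≤ b) :
    1 + (b : ℝ)⁻¹ ≤ 1 + (a : ℝ)⁻¹ := by
  have h1 : (0 : ℝ) < a := by exact_mod_cast ha
  have h2 : (a : ℝ) ≤ b := by exact_mod_cast hab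
  have := inv_anti₀ h1 h2
  linarith

lemma one_add_inv_lt {a b : ℕ} (ha : 1 ≤ a) (hab : a < b) :
    1 + (b : ℝ)⁻¹ < 1 + (a : ℝ)⁻¹ := by
  have h1 : (0 : ℝ) < a := by exact_mod_cast ha
  have h2 : (a : ℝ) < b := by exact_mod_cast hab
  have := inv_strictAnti₀ h1 h2
  linarith

lemma one_add_inv_lt_three (a : ℕ) : 1 + (a : ℝ)⁻¹ < 3 := by
  have := Nat.cast_inv_le_one (α := ℝ) a
  linarith

open Classical in
/-- The profile whose thresholds equal the average cumulative valuation of `R ^ i - 1` units, up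
to unit `R ^ i - 1` if `i` is odd and throughout if `i` is even. -/
noncomputable def tightProfile (R K i : ℕ) : Profile K where
  c j := if j ≤ R ^ i - 1 ∨ Even i then 1 + ((R ^ i - 1 : ℕ) : ℝ)⁻¹ else 3
  mono j j' _ hjj' _ := by
    have := one_add_inv_lt_three (R ^ i - 1)
    split_ifs with h1 h2 h2
    · rfl
    · exact this.le
    · exact absurd (h2.imp_left hjj'.trans) h1
    · rfl
  nonneg j _ _ := by
    split_ifs <;> positivity

/-- The strategy with `k` bid levels whose `j`-th level bids the average cumulative valuation of
`R ^ (2 * j - 1) - 1` units up to unit `R ^ (2 * j) - 1`. -/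
noncomputable def tightStrategy (R k : ℕ) : Uniform where
  m := k
  b j := 1 + ((R ^ (2 * j - 1) - 1 : ℕ) : ℝ)⁻¹
  q j := R ^ (2 * j) - R ^ (2 * (j - 1))

variable {R k : ℕ}

lemma one_le_pow_sub_one (hR : 2 ≤ R) {i : ℕ} (hi : 1 ≤ i) : 1 ≤ R ^ i - 1 := by
  have := Nat.pow_lt_pow_right (a := R) (by omega) (show 0 < i from hi)
  simp only [pow_zero] at this
  omega

lemma tightStrategy_Q (hR : 2 ≤ R) (j : ℕ) : (tightStrategy R k).Q j = R ^ (2 * j) - 1 := by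
  induction j with
  | zero => simp
  | succ j ih =>
    have h1 := Nat.pow_lt_pow_right (a := R) (by omega) (show 2 * j < 2 * (j + 1) by omega)
    have h2 := Nat.one_le_pow (2 * j) R (by omega)
    rw [Uniform.Q_succ, ih]
    simp only [tightStrategy, Nat.add_sub_cancel]
    omega

lemma tightStrategy_isUniform (hR : 2 ≤ R) (hk : 1 ≤ k) :
    (tightStrategy R k).IsUniform (R ^ (2 * k) - 1) := by
  refine ⟨hk, fun j h1 _ => ?_, ?_, fun j h1 _ => ?_, (tightStrategy_Q hR k).le⟩
  · have := Nat.pow_lt_pow_right (a := R) (by omega) (show 2 * (j - 1) < 2 * j by omega)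
    simp only [tightStrategy]
    omega
  · simp only [tightStrategy]
    positivity
  · have hpow := Nat.pow_lt_pow_right (a := R) (by omega)
      (show 2 * j - 1 < 2 * (j + 1) - 1 by omega)
    have hone := one_le_pow_sub_one hR (show 1 ≤ 2 * j - 1 by omega)
    exact one_add_inv_lt hone (by omega)

lemma tight_alloc (hR : 2 ≤ R) {i : ℕ} (hi : 1 ≤ i) (hik : i ≤ 2 * k) :
    alloc (R ^ (2 * k)) (tightStrategy R k).toBidVec (tightProfile R (R ^ (2 * k)) i)
      = R ^ i - 1 := by
  have hQ := tightStrategy_Q (k := k) hR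
  have hdem : (tightStrategy R k).Q (tightStrategy R k).m = R ^ (2 * k) - 1 := hQ k
  have hy := one_le_pow_sub_one hR hi
  have hyk := Nat.pow_le_pow_right (n := R) (by omega) hik
  refine le_antisymm ?_ (le_alloc hy ?_ (by omega) fun u h1 h2 => ?_)
  · by_contra! hcon
    obtain ⟨hn, -, hspec⟩ := alloc_spec (K := R ^ (2 * k)) (b := (tightStrategy R k).toBidVec)
      (β := tightProfile R (R ^ (2 * k)) i)
    have hn' := hn.trans hdem.le
    have hcu := hspec (R ^ i - 1 + 1) (by omega) hcon
    obtain ⟨j, hj1, -, hlt, hle, hbid⟩ :=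
      (tightStrategy R k).exists_bucket (j := R ^ i - 1 + 1) (by omega) (by omega)
    rw [hQ] at hle
    have hij : i < 2 * j := (Nat.pow_lt_pow_iff_right (a := R) (by omega)).1 (by omega)
    rw [hbid] at hcu
    simp only [tightProfile, tightStrategy] at hcu
    split_ifs at hcu with heven
    · have hE : Even i := heven.resolve_left (by omega)
      have hlt' : i < 2 * j - 1 := by
        obtain ⟨e, rfl⟩ := hE
        omega
      have hpow := Nat.pow_lt_pow_right (a := R) (by omega) hlt'
      have := one_add_inv_lt hy (show R ^ i - 1 < R ^ (2 * j - 1) - 1 by omega)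
      linarith
    · have := one_add_inv_lt_three (R ^ (2 * j - 1) - 1)
      linarith
  · change _ ≤ (tightStrategy R k).Q (tightStrategy R k).m
    omega
  · obtain ⟨j, hj1, -, hlt, -, hbid⟩ :=
      (tightStrategy R k).exists_bucket h1 (by omega)
    rw [hQ] at hlt
    have hji : 2 * (j - 1) < i := (Nat.pow_lt_pow_iff_right (a := R) (by omega)).1 (by omega)
    have hone := one_le_pow_sub_one hR (show 1 ≤ 2 * j - 1 by omega)
    have hpow := Nat.pow_le_pow_right (n := R) (by omega) (show 2 * j - 1 ≤ i by omega)
    rw [hbid]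
    simp only [tightProfile, tightStrategy, h2, true_or, if_true]
    exact one_add_inv_le hone (by omega)

lemma tight_feasible (hR : 2 ≤ R) {i : ℕ} (hi : 1 ≤ i) (hik : i ≤ 2 * k) :
    Feasible tightVal (R ^ (2 * k)) (tightStrategy R k).toBidVec
      (tightProfile R (R ^ (2 * k)) i) := by
  have hy := one_le_pow_sub_one hR hi
  have hyk := Nat.pow_le_pow_right (n := R) (by omega) hik
  refine feasible_of_price_le ?_
  rw [price, tight_alloc hR hi hik, if_neg (by omega), if_pos (by omega), w_tightVal hy]
  rcases Nat.even_or_odd i with hE | ⟨e, he⟩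
  · refine (min_le_right _ _).trans ?_
    simp [tightProfile, hE]
  · refine (min_le_left _ _).trans ?_
    have h1 := Nat.pow_lt_pow_right (a := R) (by omega) (show 2 * e < i by omega)
    have h2 := Nat.pow_lt_pow_right (a := R) (by omega) (show i < 2 * (e + 1) by omega)
    have h3 := Nat.one_le_pow (2 * e) R (by omega)
    rw [(tightStrategy R k).bid_eq (ℓ := e + 1)
      (by rw [tightStrategy_Q hR, Nat.add_sub_cancel]; omega)
      (by rw [tightStrategy_Q hR]; omega)]
    simp only [tightStrategy]
    rw [show 2 * (e + 1) - 1 = i by omega]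

lemma cast_pow_sub_one_add_one (hR : 2 ≤ R) (i : ℕ) :
    ((R ^ i - 1 : ℕ) : ℝ) + 1 = (R : ℝ) ^ i := by
  have := Nat.one_le_pow i R (by omega)
  rw [Nat.cast_sub this]
  push_cast
  ring

lemma tight_value (hR : 2 ≤ R) {i : ℕ} (hi : 1 ≤ i) (hik : i ≤ 2 * k) :
    value tightVal (R ^ (2 * k)) (tightStrategy R k).toBidVec
      (tightProfile R (R ^ (2 * k)) i) = (R : ℝ) ^ i := by
  rw [value, tight_alloc hR hi hik, sum_tightVal (one_le_pow_sub_one hR hi),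
    cast_pow_sub_one_add_one hR]

/-- Against the `i`-th tight profile a safe strategy wins almost nothing unless one of its
cumulative quantities lies in `[R ^ (i - 1), R ^ i)`. -/
lemma InSafeClass.value_tightProfile_le {M K m : ℕ} {s : Uniform} (hR : 2 ≤ R)
    (hs : InSafeClass M tightVal m s) {i : ℕ} (hi : 1 ≤ i) :
    value tightVal K s.toBidVec (tightProfile R K i) ≤ (R : ℝ) ^ (i - 1) +
      if i - 1 ∈ (Finset.Icc 1 s.m).image (fun ℓ => Nat.log R (s.Q ℓ)) then (R : ℝ) ^ i else 0 := by
  obtain ⟨-, -, hq, -, hb⟩ := hs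
  have hy := one_le_pow_sub_one hR hi
  obtain ⟨hn, -, hspec⟩ := alloc_spec (K := K) (b := s.toBidVec) (β := tightProfile R K i)
  have hite : (0 : ℝ) ≤ if i - 1 ∈ (Finset.Icc 1 s.m).image (fun ℓ => Nat.log R (s.Q ℓ)) then
      (R : ℝ) ^ i else 0 := by
    split_ifs <;> positivity
  unfold value
  set r := alloc K s.toBidVec (tightProfile R K i)
  rcases Nat.eq_zero_or_pos r with h0 | h0
  · rw [h0]
    simpa using add_nonneg (by positivity) hite
  obtain ⟨ℓ, hℓ1, hℓm, hlt, hle, hbid⟩ := s.exists_bucket h0 hn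
  have hQ1 := s.one_le_Q hq hℓ1 hℓm
  have hQy : s.Q ℓ ≤ R ^ i - 1 := by
    by_contra! hcon
    have hc := hspec r h0 le_rfl
    rw [hbid, hb ℓ hℓ1 hℓm, w_tightVal hQ1] at hc
    simp only [tightProfile] at hc
    split_ifs at hc
    · have := one_add_inv_lt hy hcon
      linarith
    · have := one_add_inv_lt_three (s.Q ℓ)
      linarith
  have hmono : ∀ {e : ℕ}, s.Q ℓ ≤ R ^ e - 1 →
      ∑ ℓ ∈ Finset.Icc 1 r, tightVal ℓ ≤ (R : ℝ) ^ e := fun {e} he => by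
    rw [← cast_pow_sub_one_add_one hR]
    refine (sum_tightVal_le r).trans ?_
    have : (r : ℝ) ≤ ((R ^ e - 1 : ℕ) : ℝ) := by exact_mod_cast hle.trans he
    linarith
  rcases Nat.lt_or_ge (s.Q ℓ) (R ^ (i - 1)) with hsmall | hbig
  · have := hmono (e := i - 1) (by omega)
    linarith
  · have hlog : Nat.log R (s.Q ℓ) = i - 1 := by
      refine Nat.log_eq_of_pow_le_of_lt_pow hbig ?_
      rw [Nat.sub_add_cancel hi]
      omega
    rw [if_pos (Finset.mem_image.2 ⟨ℓ, Finset.mem_Icc.2 ⟨hℓ1, hℓm⟩, hlog⟩)]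
    have := hmono hQy
    have : (0 : ℝ) ≤ (R : ℝ) ^ (i - 1) := by positivity
    linarith

lemma sum_log_eq (hR : 2 ≤ R) (f : ℕ → ℝ) (n : ℕ) :
    ∑ t ∈ Finset.Icc 1 (R ^ n - 1), f (Nat.log R t)
      = ((R : ℝ) - 1) * ∑ a ∈ Finset.range n, (R : ℝ) ^ a * f a := by
  have hIco : ∀ n, Finset.Icc 1 (R ^ n - 1) = Finset.Ico 1 (R ^ n) := fun n => by
    have := Nat.one_le_pow n R (by omega)
    ext x
    simp only [Finset.mem_Icc, Finset.mem_Ico]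
    omega
  rw [hIco]
  induction n with
  | zero => simp
  | succ n ih =>
    have hle := Nat.pow_le_pow_right (n := R) (by omega) (Nat.le_add_right n 1)
    rw [← Finset.sum_Ico_consecutive _ (Nat.one_le_pow n R (by omega)) hle, ih,
      Finset.sum_range_succ, mul_add]
    congr 1
    rw [Finset.sum_congr rfl (g := fun _ => f n) fun t ht => ?_]
    · rw [Finset.sum_const, Nat.card_Ico, nsmul_eq_mul, Nat.cast_sub hle]
      push_cast
      ring
    · rw [Finset.mem_Ico] at ht
      rw [Nat.log_eq_of_pow_le_of_lt_pow ht.1 ht.2]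

/-- The history on rounds `1, …, R ^ n - 1` in which the `i`-th tight profile occurs
`(R - 1) * R ^ (n - i)` times. -/
noncomputable def tightHistory (R K n t : ℕ) : Profile K := tightProfile R K (n - Nat.log R t)

lemma one_le_sub_log {n t : ℕ} (ht : t ∈ Finset.Icc 1 (R ^ n - 1)) :
    1 ≤ n - Nat.log R t := by
  rw [Finset.mem_Icc] at ht
  have := Nat.log_lt_of_lt_pow (b := R) (x := n) (y := t) (by omega) (by omega)
  omega

lemma tight_inFeasClass (hR : 2 ≤ R) (hk : 1 ≤ k) :
    InFeasClass (R ^ (2 * k) - 1) tightVal (R ^ (2 * k)) (R ^ (2 * k) - 1)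
      (tightHistory R (R ^ (2 * k)) (2 * k)) k (tightStrategy R k) :=
  ⟨tightStrategy_isUniform hR hk, le_rfl, fun _ ht =>
    tight_feasible hR (one_le_sub_log ht) (Nat.sub_le _ _)⟩

lemma tight_totalValue (hR : 2 ≤ R) :
    totalValue tightVal (R ^ (2 * k)) (R ^ (2 * k) - 1) (tightHistory R (R ^ (2 * k)) (2 * k))
      (tightStrategy R k) = ((R : ℝ) - 1) * ((2 * k : ℕ) * (R : ℝ) ^ (2 * k)) := by
  unfold totalValue tightHistory
  rw [Finset.sum_congr rfl fun t ht =>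
      tight_value (k := k) hR (one_le_sub_log ht) (Nat.sub_le _ _),
    sum_log_eq hR fun a => (R : ℝ) ^ (2 * k - a)]
  congr 1
  rw [Finset.sum_congr rfl (g := fun _ => (R : ℝ) ^ (2 * k)) fun a ha => ?_]
  · simp
  · rw [Finset.mem_range] at ha
    rw [← pow_add]
    congr 1
    omega

lemma InSafeClass.totalValue_tightHistory_le {M K m n : ℕ} {s : Uniform} (hR : 2 ≤ R)
    (hs : InSafeClass M tightVal m s) :
    totalValue tightVal K (R ^ n - 1) (tightHistory R K n) s
      ≤ ((R : ℝ) - 1) * (n * (R : ℝ) ^ (n - 1) + m * (R : ℝ) ^ n) := by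
  have hR1 : (0 : ℝ) ≤ (R : ℝ) - 1 := by
    have : (2 : ℝ) ≤ R := by exact_mod_cast hR
    linarith
  set A := (Finset.Icc 1 s.m).image (fun ℓ => Nat.log R (s.Q ℓ))
  have hAm : #A ≤ m := by
    refine Finset.card_image_le.trans ?_
    simpa using hs.2.1
  refine (Finset.sum_le_sum fun t ht =>
    hs.value_tightProfile_le hR (one_le_sub_log ht)).trans ?_
  rw [sum_log_eq hR fun a => (R : ℝ) ^ (n - a - 1) + if n - a - 1 ∈ A then (R : ℝ) ^ (n - a) else 0]
  refine mul_le_mul_of_nonneg_left ?_ hR1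
  calc _ = ∑ a ∈ Finset.range n,
        ((R : ℝ) ^ (n - 1) + if n - a - 1 ∈ A then (R : ℝ) ^ n else 0) := by
        refine Finset.sum_congr rfl fun a ha => ?_
        rw [Finset.mem_range] at ha
        rw [mul_add, mul_ite, mul_zero, ← pow_add, ← pow_add, show a + (n - a - 1) = n - 1 by omega,
          show a + (n - a) = n by omega]
    _ = n * (R : ℝ) ^ (n - 1) + #{a ∈ Finset.range n | n - a - 1 ∈ A} * (R : ℝ) ^ n := by
        rw [Finset.sum_add_distrib, ← Finset.sum_filter]
        simp
    _ ≤ _ := by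
        have hcard : #{a ∈ Finset.range n | n - a - 1 ∈ A} ≤ m := by
          refine le_trans (Finset.card_le_card_of_injOn (fun a => n - a - 1) ?_ ?_) hAm
          · intro a ha
            exact (Finset.mem_filter.1 ha).2
          · intro a ha a' ha' h
            simp only [Finset.coe_filter, Finset.mem_range, Set.mem_ofPred_eq] at ha ha' h
            omega
        gcongr

end Tightness

/-- Theorem `thm:mbar-non-safe`: for `m ≤ m'`, the optimal value over
RoI-feasible strategies with at most `m'` pairs is at most `2m'/m` times the optimal
value over safe undominated strategies with at most `m` pairs, and this factor is
tight. -/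
theorem richness_feas_vs_safe (m m' : ℕ) (hm : 1 ≤ m) (hmm' : m ≤ m') :
    (∀ (K M T : ℕ) (v : ℕ → ℝ), ValidValuation M v → M ≤ K → ∀ H : ℕ → Profile K,
      bestFeas M v K T H m' ≤ (2 * (m' : ℝ) / (m : ℝ)) * bestSafe M v K T H m) ∧
    (∀ δ : ℝ, 0 < δ → δ ≤ 1 / 2 →
      ∃ (T K M : ℕ) (v : ℕ → ℝ) (H : ℕ → Profile K),
        1 ≤ T ∧ 1 ≤ K ∧ 1 ≤ M ∧ M ≤ K ∧ ValidValuation M v ∧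
        0 < bestSafe M v K T H m ∧
        ∃ s : Uniform, InFeasClass M v K T H m' s ∧
          (2 * (m' : ℝ) / (m : ℝ) - δ) * bestSafe M v K T H m ≤ totalValue v K T H s) := by
  refine ⟨fun K M T v hv hMK H => bestFeas_le hv hMK hm hmm', fun δ hδ hδ2 => ?_⟩
  obtain ⟨R₀, hR₀⟩ := exists_nat_ge (((2 * m' : ℕ) : ℝ) ^ 2 / δ)
  set R := max 2 R₀
  have hR : 2 ≤ R := le_max_left _ _
  have hRδ : ((2 * m' : ℕ) : ℝ) ^ 2 ≤ R * δ := by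
    rw [← div_le_iff₀ hδ]
    exact hR₀.trans (by exact_mod_cast le_max_right _ _)
  have hm'1 : 1 ≤ m' := hm.trans hmm'
  have hfeas := tight_inFeasClass hR hm'1
  have htotal := tight_totalValue (k := m') hR
  have hM := one_le_pow_sub_one hR (show 1 ≤ 2 * m' by omega)
  set n := 2 * m' with hn
  have hR0 : (2 : ℝ) ≤ R := by exact_mod_cast hR
  have hR1 : (0 : ℝ) < (R : ℝ) - 1 := by linarith
  have hn0 : (2 : ℝ) ≤ n := by
    have : 2 ≤ n := by omega
    exact_mod_cast this
  have hm1 : (1 : ℝ) ≤ m := by exact_mod_cast hm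
  have hmn : (m : ℝ) ≤ n := by
    have : m ≤ n := by omega
    exact_mod_cast this
  have hm0 : (0 : ℝ) < m := by linarith
  have hv := tightVal_valid (R ^ n - 1)
  have hpos : 0 < bestSafe (R ^ n - 1) tightVal (R ^ n) (R ^ n - 1) (tightHistory R (R ^ n) n) m := by
    have h1 := totalValue_le_bestFeas hv hfeas
    have h2 := bestFeas_le (T := R ^ n - 1) (H := tightHistory R (R ^ n) n) hv
      (Nat.sub_le (R ^ n) 1) hm hmm'
    rw [htotal] at h1
    have h3 : 0 < ((R : ℝ) - 1) * (n * (R : ℝ) ^ n) := by positivity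
    exact pos_of_mul_pos_right (h3.trans_le (h1.trans h2)) (by positivity)
  refine ⟨R ^ n - 1, R ^ n, R ^ n - 1, tightVal, tightHistory R (R ^ n) n, hM, by omega, hM,
    Nat.sub_le _ _, hv, hpos, tightStrategy R m', hfeas, ?_⟩
  have hbest : bestSafe (R ^ n - 1) tightVal (R ^ n) (R ^ n - 1) (tightHistory R (R ^ n) n) m
      ≤ ((R : ℝ) - 1) * (n * (R : ℝ) ^ (n - 1) + m * (R : ℝ) ^ n) := by
    refine Real.sSup_le ?_ (by positivity)
    rintro x ⟨s, hs, rfl⟩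
    exact hs.totalValue_tightHistory_le hR
  have hfrac : 2 * (m' : ℝ) / m = n / m := by
    rw [hn]
    push_cast
    rfl
  have hcoef : 0 ≤ (n : ℝ) / m - δ := by
    have : (1 : ℝ) ≤ n / m := by rwa [le_div_iff₀ hm0, one_mul]
    linarith
  have hpow : (R : ℝ) ^ n = R * (R : ℝ) ^ (n - 1) := by
    rw [← pow_succ', Nat.sub_add_cancel (by omega)]
  rw [hfrac, htotal]
  refine (mul_le_mul_of_nonneg_left hbest hcoef).trans ?_
  have hcore : ((n : ℝ) / m - δ) * (n + m * R) ≤ n * R := by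
    have h1 : (n : ℝ) / m * (n + m * R) = (n : ℝ) ^ 2 / m + n * R := by
      field_simp
    have h2 : (n : ℝ) ^ 2 / m ≤ (n : ℝ) ^ 2 := div_le_self (by positivity) hm1
    have h3 : (R : ℝ) * δ ≤ m * (R * δ) := le_mul_of_one_le_left (by positivity) hm1
    have h4 : 0 ≤ δ * n := by positivity
    nlinarith
  have := mul_le_mul_of_nonneg_left hcore
    (by positivity : (0 : ℝ) ≤ ((R : ℝ) - 1) * (R : ℝ) ^ (n - 1))
  rw [hpow]
  linarith

end Auction
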